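/- arXiv:1904.04172 — 7 statements merged into one kernel-verified Lean document; each statement's English description precedes it below -/
import Mathlib

section
/- Let p be a prime, let g be an integer whose residue class generates the group of units (Z/pZ)* (i.e., g has multiplicative order p−1 mod p), and let β_1 ≥ β_2 ≥ 0 be real numbers. Then there exists an entrywise nonnegative g-circulant real matrix A of order p whose characteristic polynomial is (X − β_1)(X^{p−1} − β_2^{p−1}); equivalently, the eigenvalues of A are β_1, β_2, β_2φ, β_2φ^2, …, β_2φ^{p−2}, where φ = exp(2πi/(p−1)). -/
open Polynomial Matrix in
/-- **Brauer's theorem** on rank-one perturbations along an eigenvector. -/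
theorem Matrix.charpoly_add_vecMulVec_of_mulVec_eq_smul {n R : Type*} [Fintype n] [DecidableEq n]
    [Nonempty n] [CommRing R] (B : Matrix n n R) {s : R} {v : n → R} (hv : B *ᵥ v = s • v)
    (u : n → R) :
    (X - C s) * (B + vecMulVec v u).charpoly = (X - C (s + v ⬝ᵥ u)) * B.charpoly := by
  set V : Matrix n n R[X] := vecMulVec (C ∘ v) (C ∘ u) with hV
  have hBV : B.map C * V = C s • V := by
    ext1 i j
    have h := congrArg C (congrFun hv i)
    simp only [mulVec, dotProduct, map_sum, map_mul, Pi.smul_apply, smul_eq_mul] at h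
    simp only [hV, mul_apply, vecMulVec_apply, map_apply, Function.comp_apply, smul_apply,
      smul_eq_mul, ← mul_assoc, ← Finset.sum_mul, h]
  have hmat : B.charmatrix * (scalar n (X - C s) - V) =
      (X - C s) • (B + vecMulVec v u).charmatrix := by
    have hadd : (B + vecMulVec v u).charmatrix = B.charmatrix - V := by
      ext1 i j
      simp only [hV, charmatrix_apply, add_apply, sub_apply, vecMulVec_apply, map_add, map_mul,
        Function.comp_apply]
      ring
    have hchar : B.charmatrix * V = (X - C s) • V := by
      rw [charmatrix, sub_mul, sub_smul]
      congr 1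
      simp [← smul_eq_diagonal_mul]
    rw [hadd, mul_sub, hchar, smul_sub, scalar_apply, ← smul_one_eq_diagonal]
    simp
  have hcard : Fintype.card n = Fintype.card n - 1 + 1 := by
    have := Fintype.card_pos (α := n)
    omega
  have hdet : (scalar n (X - C s) - V).det =
      (X - C s) ^ (Fintype.card n - 1) * (X - C (s + v ⬝ᵥ u)) := by
    have hdot : (C ∘ v) ⬝ᵥ (C ∘ u) = C (v ⬝ᵥ u) := by
      simp [dotProduct]
    rw [← eval_charpoly, hV, charpoly_vecMulVec, hdot]
    simp only [eval_sub, eval_pow, eval_X, eval_smul, smul_eq_mul, map_add]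
    nth_rewrite 1 [hcard]
    ring
  have h := congrArg det hmat
  rw [det_mul, hdet, det_smul, hcard, pow_succ] at h
  refine (((monic_X_sub_C s).pow (Fintype.card n - 1)).isRegular.left) ?_
  simp only [charpoly, add_tsub_cancel_right] at h ⊢
  linear_combination -h

namespace Equiv.Perm

/-- A permutation which locally agrees with either the identity or a given cycle does so
globally. -/
theorem IsCycle.eq_one_or_eq_of_forall {n : Type*} [Finite n] {σ τ : Perm n} (hσ : σ.IsCycle)
    (h : ∀ i, τ i = i ∨ τ i = σ i) : τ = 1 ∨ τ = σ := by
  refine or_iff_not_imp_left.2 fun hτ => ?_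
  obtain ⟨i, hi⟩ : ∃ i, τ i ≠ i := by
    by_contra! hc
    exact hτ (ext hc)
  have hσi : σ i ≠ i := (h i).resolve_left hi ▸ hi
  have hpow : ∀ k : ℕ, τ ((σ ^ k) i) ≠ (σ ^ k) i := by
    intro k
    induction k with
    | zero => exact hi
    | succ k ih =>
      have hk := (h _).resolve_left ih
      rw [pow_succ', mul_apply, ← hk]
      exact fun hc => ih (τ.injective hc)
  ext j
  rcases eq_or_ne (σ j) j with hj | hj
  · rcases h j with h' | h'
    · rw [h', hj]
    · exact h'
  · obtain ⟨k, rfl⟩ := hσ.exists_pow_eq hσi hj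
    exact (h _).resolve_left (hpow k)

open Polynomial in
theorem IsCycle.charpoly_smul_permMatrix {n R : Type*} [Fintype n] [DecidableEq n] [CommRing R]
    {σ : Perm n} (hσ : σ.IsCycle) (b : R) :
    (b • σ.permMatrix R).charpoly =
      (X - C b) ^ (Fintype.card n - σ.support.card) *
        (X ^ σ.support.card - C (b ^ σ.support.card)) := by
  have happ : ∀ i j, (b • σ.permMatrix R).charmatrix i j =
      (if i = j then X else 0) - (if σ i = j then C b else 0) := by
    intro i j
    rw [Matrix.charmatrix_apply, Matrix.diagonal_apply]
    simp [permMatrix, PEquiv.toMatrix_apply, toPEquiv_apply, apply_ite C, eq_comm]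
  have hsplit (f : n → R[X]) : ∏ i, f i =
      (∏ i ∈ σ.supportᶜ, f i) * ∏ i ∈ σ.support, f i :=
    (Finset.prod_compl_mul_prod _ _).symm
  rw [Matrix.charpoly, ← Matrix.det_transpose, Matrix.det_apply']
  simp only [Matrix.transpose_apply, happ]
  rw [← Finset.sum_subset (Finset.subset_univ {1, σ}), Finset.sum_pair hσ.ne_one.symm,
    hsplit, hsplit]
  · have hfix (τ : Perm n) (hτ : τ = 1 ∨ τ = σ) : ∏ i ∈ σ.supportᶜ,
        ((if i = τ i then X else 0) - (if σ i = τ i then C b else 0)) =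
          (X - C b) ^ (Fintype.card n - σ.support.card) := by
      rw [← Finset.card_compl, ← Finset.prod_const]
      refine Finset.prod_congr rfl fun i hi => ?_
      have hi' : σ i = i := by simpa using hi
      rcases hτ with rfl | rfl <;> simp [hi']
    have hone : ∏ i ∈ σ.support, ((if i = (1 : Perm n) i then X else 0) -
        (if σ i = (1 : Perm n) i then C b else 0)) = X ^ σ.support.card := by
      rw [← Finset.prod_const]
      refine Finset.prod_congr rfl fun i hi => ?_
      simp [mem_support.1 hi]
    have hcyc : ∏ i ∈ σ.support, ((if i = σ i then X else 0) -
        (if σ i = σ i then C b else 0)) = (-C b) ^ σ.support.card := by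
      rw [← Finset.prod_const]
      refine Finset.prod_congr rfl fun i hi => ?_
      simp [(mem_support.1 hi).symm]
    rw [hfix 1 (.inl rfl), hfix σ (.inr rfl), hone, hcyc, hσ.sign, neg_pow (C b), C_pow]
    have hsq : ((-1 : R[X]) ^ σ.support.card) * (-1) ^ σ.support.card = 1 := by
      rw [← mul_pow]
      simp
    push_cast
    simp only [sign_one, Units.val_one, Int.cast_one]
    linear_combination (-(X - C b) ^ (Fintype.card n - σ.support.card) *
      C b ^ σ.support.card) * hsq
  · intro τ _ hτ
    obtain ⟨i, hi⟩ : ∃ i, ¬ (τ i = i ∨ τ i = σ i) := by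
      by_contra! hc
      exact hτ (by simpa using hσ.eq_one_or_eq_of_forall hc)
    rw [not_or] at hi
    rw [Finset.prod_eq_zero (Finset.mem_univ i), mul_zero]
    simp [Ne.symm hi.1, Ne.symm hi.2]

end Equiv.Perm

/-- Multiplication by a primitive root modulo `p` is a cycle on `ZMod p`. -/
theorem ZMod.isCycle_mulLeft₀ {p : ℕ} [Fact p.Prime] (hp : p ≠ 2) {a : ZMod p} (ha : a ≠ 0)
    (h : orderOf a = p - 1) : (Equiv.mulLeft₀ a ha).IsCycle := by
  have hp2 : 2 < p := lt_of_le_of_ne (Fact.out : p.Prime).two_le hp.symm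
  have ha1 : a ≠ 1 := by
    rintro rfl
    rw [orderOf_one] at h
    omega
  have hpow (k : ℕ) : ((Equiv.mulLeft₀ a ha) ^ k) 1 = a ^ k := by
    induction k with
    | zero => simp
    | succ k ih => rw [pow_succ', Equiv.Perm.mul_apply, ih, pow_succ']; rfl
  refine ⟨1, by simpa using ha1, fun y hy => ?_⟩
  have hy0 : y ≠ 0 := by
    rintro rfl
    simp at hy
  set u := Units.mk0 a ha
  have hu : Subgroup.zpowers u = ⊤ := by
    apply Subgroup.eq_top_of_card_eq
    rw [Nat.card_zpowers, ← orderOf_units, Units.val_mk0, h, Nat.card_eq_fintype_card,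
      ZMod.card_units]
  obtain ⟨k, hk⟩ := mem_powers_iff_mem_zpowers.2 (hu ▸ Subgroup.mem_top (Units.mk0 y hy0))
  refine ⟨k, ?_⟩
  rw [zpow_natCast, hpow]
  simpa [u] using congrArg Units.val hk

open Polynomial in
theorem ZMod.charpoly_smul_permMatrix_mulLeft₀ {p : ℕ} [Fact p.Prime] {R : Type*} [CommRing R]
    {a : ZMod p} (ha : a ≠ 0) (h : orderOf a = p - 1) (b : R) :
    (b • (Equiv.mulLeft₀ a ha).permMatrix R).charpoly =
      (X - C b) * (X ^ (p - 1) - C (b ^ (p - 1))) := by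
  rcases eq_or_ne p 2 with rfl | hp
  · have ha1 : a = 1 := orderOf_eq_one_iff.1 h
    subst ha1
    have hone : Equiv.mulLeft₀ (1 : ZMod 2) ha = 1 := by
      ext1 x
      simp
    rw [hone, Matrix.permMatrix_one, Matrix.charpoly, ← Matrix.diagonal_one,
      ← Matrix.diagonal_smul, Matrix.charmatrix_diagonal, Matrix.det_diagonal]
    simp [ZMod.card, pow_two]
  · have hp2 : 2 < p := lt_of_le_of_ne (Fact.out : p.Prime).two_le hp.symm
    have ha1 : a ≠ 1 := by
      rintro rfl
      rw [orderOf_one] at h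
      omega
    have hsupp : (Equiv.mulLeft₀ a ha).support.card = p - 1 := by
      have : (Equiv.mulLeft₀ a ha).support = {0}ᶜ := by
        ext x
        by_cases hx : x = 0 <;> simp [hx, ha1]
      rw [this, Finset.card_compl, Finset.card_singleton, ZMod.card]
    rw [(ZMod.isCycle_mulLeft₀ hp ha h).charpoly_smul_permMatrix, hsupp, ZMod.card,
      show p - (p - 1) = 1 by omega, pow_one]

/-- For a prime `p`, an integer `g` of multiplicative order `p-1` mod `p`,
and reals `β₁ ≥ β₂ ≥ 0`, there exists an entrywise nonnegative `g`-circulant real matrix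
`A` of order `p` (i.e. `A i j = a (j - g·i)` where `a` is the first row of `A`) whose
characteristic polynomial is `(X - β₁)(X^{p-1} - β₂^{p-1})`. -/
theorem exists_nonneg_gcirc_with_spectrum
    (p : ℕ) [Fact p.Prime] (g : ℤ) (hg : orderOf ((g : ZMod p)) = p - 1)
    (β₁ β₂ : ℝ) (h1 : β₂ ≤ β₁) (h2 : 0 ≤ β₂) :
    ∃ A : Matrix (ZMod p) (ZMod p) ℝ,
      (∀ i j : ZMod p, A i j = A 0 (j - (g : ZMod p) * i)) ∧
      (∀ i j : ZMod p, 0 ≤ A i j) ∧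
      A.charpoly = (Polynomial.X - Polynomial.C β₁) *
        (Polynomial.X ^ (p - 1) - Polynomial.C (β₂ ^ (p - 1))) := by
  have hp : p.Prime := Fact.out
  have hp0 : (p : ℝ) ≠ 0 := Nat.cast_ne_zero.2 hp.ne_zero
  have hg0 : (g : ZMod p) ≠ 0 := by
    intro h0
    have h := pow_orderOf_eq_one (g : ZMod p)
    rw [hg, h0, zero_pow (Nat.sub_pos_of_lt hp.one_lt).ne'] at h
    exact zero_ne_one h
  set c : ℝ := (β₁ - β₂) / p with hc
  have hc0 : 0 ≤ c := div_nonneg (sub_nonneg.2 h1) (Nat.cast_nonneg p)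
  obtain ⟨B, hB⟩ : ∃ B : Matrix (ZMod p) (ZMod p) ℝ,
      B = β₂ • (Equiv.mulLeft₀ (g : ZMod p) hg0).permMatrix ℝ := ⟨_, rfl⟩
  have happ : ∀ i j, (B + Matrix.vecMulVec 1 (fun _ => c) : Matrix (ZMod p) (ZMod p) ℝ) i j =
      (if j - (g : ZMod p) * i = 0 then β₂ else 0) + c := by
    intro i j
    simp [hB, Equiv.Perm.permMatrix, PEquiv.toMatrix_apply, Equiv.toPEquiv_apply,
      sub_eq_zero, eq_comm]
  refine ⟨B + Matrix.vecMulVec 1 (fun _ => c), fun i j => ?_, fun i j => ?_, ?_⟩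
  · simp only [happ, mul_zero, sub_zero]
  · rw [happ]
    split_ifs <;> positivity
  · have hv : B.mulVec 1 = β₂ • 1 := by
      rw [hB, Matrix.smul_mulVec, Matrix.permMatrix_mulVec]
      rfl
    have hsum : β₂ + dotProduct (1 : ZMod p → ℝ) (fun _ => c) = β₁ := by
      simp only [one_dotProduct, Finset.sum_const, Finset.card_univ, ZMod.card, nsmul_eq_mul, hc]
      field_simp
      ring
    have h := Matrix.charpoly_add_vecMulVec_of_mulVec_eq_smul B hv (fun _ => c)
    rw [hsum, hB, ZMod.charpoly_smul_permMatrix_mulLeft₀ hg0 hg] at h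
    refine mul_left_cancel₀ (Polynomial.X_sub_C_ne_zero β₂) ?_
    rw [hB, h]
    ring
end

section
/- Let p > 2 be a prime, let g be an integer whose residue class generates the group of units (Z/pZ)*, let β_1 ∈ ℝ and β_2 > 0. Set τ = exp(2πi/p) and φ = exp(2πi/(p−1)). Define λ_0 = β_1 and λ_ℓ = β_2 τ^ℓ for ℓ ∈ Z/pZ, ℓ ≠ 0, and define c_k = (1/p) Σ_{ℓ∈Z/pZ} λ_ℓ τ^{−kℓ} for k ∈ Z/pZ. Then every c_k is a real number, and the matrix A = Q_g · circ(c) is a real g-circulant matrix whose set of complex eigenvalues equals {β_1} ∪ {β_2 φ^k : 0 ≤ k ≤ p−2} = {β_1} ∪ {z ∈ ℂ : z^{p−1} = β_2^{p−1}}. -/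
open Matrix in
theorem Matrix.mem_spectrum_iff_exists_mulVec {ι K : Type*} [Fintype ι] [DecidableEq ι] [Field K]
    (A : Matrix ι ι K) (z : K) : z ∈ spectrum K A ↔ ∃ v ≠ 0, A *ᵥ v = z • v := by
  rw [spectrum.mem_iff, Matrix.isUnit_iff_isUnit_det, isUnit_iff_ne_zero, not_not,
    ← Matrix.exists_mulVec_eq_zero_iff]
  refine exists_congr fun v => and_congr_right fun _ => ?_
  rw [Matrix.sub_mulVec, sub_eq_zero, eq_comm, Algebra.algebraMap_eq_smul_one, Matrix.smul_mulVec,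
    Matrix.one_mulVec]

open Matrix in
theorem Matrix.pow_mulVec_eq_smul {ι K : Type*} [Fintype ι] [DecidableEq ι] [CommRing K]
    {A : Matrix ι ι K} {z : K} {v : ι → K} (h : A *ᵥ v = z • v) (n : ℕ) :
    (A ^ n) *ᵥ v = z ^ n • v := by
  induction n with
  | zero => simp
  | succ n ih =>
    rw [pow_succ, ← Matrix.mulVec_mulVec, h, Matrix.mulVec_smul, ih, smul_smul, pow_succ']

/-- If `z ^ n` is the scalar by which `A ^ n` acts on `v`, then the `z`-average of the orbit of `v`
under `A` satisfies the eigenvector equation for `z`. -/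
theorem Matrix.mulVec_sum_inv_pow_smul {ι K : Type*} [Fintype ι] [DecidableEq ι] [Field K]
    {A : Matrix ι ι K} {z : K} (hz : z ≠ 0) {v : ι → K} {n : ℕ}
    (h : (A ^ n).mulVec v = z ^ n • v) :
    A.mulVec (∑ k ∈ Finset.range n, z⁻¹ ^ k • (A ^ k).mulVec v) =
      z • ∑ k ∈ Finset.range n, z⁻¹ ^ k • (A ^ k).mulVec v := by
  have hstep : ∀ k, A.mulVec (z⁻¹ ^ k • (A ^ k).mulVec v) =
      z • (z⁻¹ ^ (k + 1) • (A ^ (k + 1)).mulVec v) := by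
    intro k
    rw [Matrix.mulVec_smul, Matrix.mulVec_mulVec, ← pow_succ', smul_smul, pow_succ' z⁻¹,
      mul_inv_cancel_left₀ hz]
  have hcycle : z⁻¹ ^ n • (A ^ n).mulVec v = v := by
    rw [h, smul_smul, ← mul_pow, inv_mul_cancel₀ hz, one_pow, one_smul]
  rw [Matrix.mulVec_sum, Finset.sum_congr rfl fun k _ => hstep k, ← Finset.smul_sum]
  congr 1
  have := (Finset.sum_range_succ (fun k => z⁻¹ ^ k • (A ^ k).mulVec v) n).symm.trans
    (Finset.sum_range_succ' (fun k => z⁻¹ ^ k • (A ^ k).mulVec v) n)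
  simp only [hcycle, pow_zero, Matrix.one_mulVec, one_smul] at this
  exact (add_right_cancel this).symm

namespace ZMod

variable {N : ℕ} [NeZero N]

/-- The Fourier vector of frequency `m` on `ZMod N`. -/
noncomputable def fourierVec (m : ZMod N) : ZMod N → ℂ := fun j => stdAddChar (j * m)

theorem sum_stdAddChar_mul (m : ZMod N) :
    ∑ j : ZMod N, (stdAddChar (j * m) : ℂ) = if m = 0 then (N : ℂ) else 0 := by
  rw [AddChar.sum_mulShift m (isPrimitive_stdAddChar N)]
  simp

theorem sum_fourierVec_mul_neg (m l : ZMod N) :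
    ∑ j : ZMod N, fourierVec m j * stdAddChar (-(j * l)) = if m = l then (N : ℂ) else 0 := by
  simp only [fourierVec, ← AddChar.map_add_eq_mul, ← sub_eq_add_neg, ← mul_sub]
  rw [sum_stdAddChar_mul]
  simp only [sub_eq_zero]

theorem fourierVec_ne_zero (m : ZMod N) : fourierVec m ≠ 0 := fun h => by
  simpa [fourierVec] using congrFun h 0

theorem matrix_eq_zero_of_mulVec_fourierVec {M : Matrix (ZMod N) (ZMod N) ℂ}
    (h : ∀ m, M.mulVec (fourierVec m) = 0) : M = 0 := by
  ext i j
  have h1 : ∑ m : ZMod N, (M.mulVec (fourierVec m)) i * stdAddChar (-(j * m)) = 0 := by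
    simp [h]
  have h2 : ∑ m : ZMod N, (M.mulVec (fourierVec m)) i * stdAddChar (-(j * m)) =
      ∑ k, M i k * ∑ m, fourierVec k m * stdAddChar (-(m * j)) := by
    simp only [Matrix.mulVec, dotProduct, Finset.sum_mul, Finset.mul_sum]
    rw [Finset.sum_comm]
    refine Finset.sum_congr rfl fun k _ => Finset.sum_congr rfl fun m _ => ?_
    rw [fourierVec, fourierVec, mul_comm k m, mul_comm j m, mul_assoc]
  simp only [h2, sum_fourierVec_mul_neg, mul_ite, mul_zero, Finset.sum_ite_eq', Finset.mem_univ,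
    if_true] at h1
  simpa [NeZero.ne N] using h1

theorem exp_pow_val (l : ZMod N) :
    Complex.exp (2 * Real.pi * Complex.I / N) ^ l.val = stdAddChar l := by
  rw [← Complex.exp_nat_mul]
  have h := stdAddChar_coe (N := N) (l.val : ℤ)
  rw [Int.cast_natCast, natCast_zmod_val] at h
  rw [h]
  congr 1
  push_cast
  ring

theorem exp_zpow_neg_val_mul_val (k l : ZMod N) :
    Complex.exp (2 * Real.pi * Complex.I / N) ^ (-(k.val * l.val : ℤ)) =
      stdAddChar (-(k * l)) := by
  rw [← Complex.exp_int_mul]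
  have h := stdAddChar_coe (N := N) (-(k.val * l.val : ℤ))
  push_cast at h
  rw [natCast_zmod_val, natCast_zmod_val] at h
  rw [h]
  congr 1
  push_cast
  ring

theorem conj_stdAddChar (x : ZMod N) :
    (starRingEnd ℂ) (stdAddChar x) = stdAddChar (-x) := by
  rw [AddChar.map_neg_eq_conj]

/-- The `g`-circulant matrix whose first row is the inverse Fourier transform of `lam` sends the
Fourier vector of frequency `m` to `lam m` times the one of frequency `g * m`. -/
theorem mulVec_fourierVec_of_gcirculant {g : ZMod N} {lam c : ZMod N → ℂ}
    {A : Matrix (ZMod N) (ZMod N) ℂ}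
    (hc : ∀ k, c k = (N : ℂ)⁻¹ * ∑ l, lam l * stdAddChar (-(k * l)))
    (hA : ∀ i j, A i j = c (j - g * i)) (m : ZMod N) :
    A.mulVec (fourierVec m) = lam m • fourierVec (g * m) := by
  have hN : (N : ℂ) ≠ 0 := NeZero.ne _
  have hinv : ∑ k, c k * fourierVec m k = lam m := by
    have : ∑ k, c k * fourierVec m k =
        (N : ℂ)⁻¹ * ∑ l, lam l * ∑ k, fourierVec m k * stdAddChar (-(k * l)) := by
      simp only [hc, Finset.mul_sum, Finset.sum_mul]
      rw [Finset.sum_comm]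
      exact Finset.sum_congr rfl fun k _ => Finset.sum_congr rfl fun l _ => by ring
    rw [this]
    simp only [sum_fourierVec_mul_neg, mul_ite, mul_zero, Finset.sum_ite_eq, Finset.mem_univ,
      if_true]
    field_simp
  ext i
  simp only [Matrix.mulVec, dotProduct, hA, Pi.smul_apply, smul_eq_mul]
  rw [← hinv, Finset.sum_mul, ← Equiv.sum_comp (Equiv.addRight (g * i))]
  refine Finset.sum_congr rfl fun k _ => ?_
  simp only [Equiv.coe_addRight, add_sub_cancel_right, fourierVec, add_mul,
    AddChar.map_add_eq_mul]
  rw [mul_comm g i, mul_assoc, mul_assoc]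

theorem im_inverse_fourier_eq_zero {lam : ZMod N → ℂ}
    (hlam : ∀ l, (starRingEnd ℂ) (lam l) = lam (-l)) (k : ZMod N) :
    ((N : ℂ)⁻¹ * ∑ l, lam l * stdAddChar (-(k * l))).im = 0 := by
  rw [← Complex.conj_eq_iff_im, map_mul, map_sum,
    ← Equiv.sum_comp (Equiv.neg (ZMod N)) fun l => lam l * stdAddChar (-(k * l))]
  simp [hlam, conj_stdAddChar]

/-- Iterating the weighted shift `e_m ↦ b χ(m) e_{g m}` on nonzero frequencies. -/
theorem pow_mulVec_fourierVec {p : ℕ} [Fact p.Prime] {g : ZMod p} (hg : g ≠ 0) {b : ℂ}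
    {A : Matrix (ZMod p) (ZMod p) ℂ}
    (hA : ∀ m ≠ 0, A.mulVec (fourierVec m) = (b * stdAddChar m) • fourierVec (g * m))
    {m : ZMod p} (hm : m ≠ 0) (k : ℕ) :
    (A ^ k).mulVec (fourierVec m) =
      (b ^ k * stdAddChar ((∑ i ∈ Finset.range k, g ^ i) * m)) • fourierVec (g ^ k * m) := by
  induction k with
  | zero => simp
  | succ k ih =>
    rw [pow_succ', ← Matrix.mulVec_mulVec, ih, Matrix.mulVec_smul,
      hA _ (mul_ne_zero (pow_ne_zero k hg) hm), smul_smul, Finset.sum_range_succ, add_mul,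
      AddChar.map_add_eq_mul, ← mul_assoc g, ← pow_succ']
    congr 1
    ring

end ZMod

/-- Let `p > 2` be prime, `g` a generator of `(ZMod p)ˣ`, `β₁ ∈ ℝ`, `β₂ > 0`.
With `τ = exp(2πi/p)`, `λ₀ = β₁`, `λ_ℓ = β₂ τ^ℓ` for `ℓ ≠ 0`, and
`c_k = (1/p) ∑_ℓ λ_ℓ τ^{-kℓ}`, every `c_k` is real and `A = Q_g ⬝ circ(c)` is a real
`g`-circulant matrix whose set of complex eigenvalues is
`{β₁} ∪ {z : z^{p-1} = β₂^{p-1}}`. -/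
theorem gcirc_construction_spectrum
    (p : ℕ) [Fact p.Prime] (hp : 2 < p) (g : ℤ)
    (hg : orderOf ((g : ZMod p)) = p - 1)
    (β₁ : ℝ) (β₂ : ℝ) (hβ₂ : 0 < β₂)
    (τ : ℂ) (hτ : τ = Complex.exp (2 * Real.pi * Complex.I / p))
    (lam : ZMod p → ℂ)
    (hlam : ∀ ℓ : ZMod p, lam ℓ = if ℓ = 0 then (β₁ : ℂ) else (β₂ : ℂ) * τ ^ ℓ.val)
    (c : ZMod p → ℂ)
    (hc : ∀ k : ZMod p, c k = (p : ℂ)⁻¹ * ∑ ℓ : ZMod p, lam ℓ * τ ^ (-(k.val * ℓ.val : ℤ)))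
    (Q C A : Matrix (ZMod p) (ZMod p) ℂ)
    (hQ : ∀ i j : ZMod p, Q i j = if j = (g : ZMod p) * i then 1 else 0)
    (hC : ∀ i j : ZMod p, C i j = c (j - i))
    (hA : A = Q * C) :
    (∀ k : ZMod p, (c k).im = 0) ∧
    (∀ i j : ZMod p, A i j = A 0 (j - (g : ZMod p) * i)) ∧
    spectrum ℂ A = insert (β₁ : ℂ) {z : ℂ | z ^ (p - 1) = (β₂ : ℂ) ^ (p - 1)} := by
  subst hτ
  simp only [ZMod.exp_pow_val] at hlam
  simp only [ZMod.exp_zpow_neg_val_mul_val] at hc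
  have hAc : ∀ i j, A i j = c (j - (g : ZMod p) * i) := by
    intro i j
    simp [hA, Matrix.mul_apply, hQ, hC]
  have hconj : ∀ l, (starRingEnd ℂ) (lam l) = lam (-l) := by
    intro l
    rw [hlam, hlam]
    by_cases hl : l = 0
    · simp [hl]
    · simp [hl, ZMod.conj_stdAddChar]
  refine ⟨fun k => by rw [hc]; exact ZMod.im_inverse_fourier_eq_zero hconj k,
    fun i j => by simp [hAc], ?_⟩
  have hshift := ZMod.mulVec_fourierVec_of_gcirculant hc hAc
  have hzero : A.mulVec (ZMod.fourierVec 0) = (β₁ : ℂ) • ZMod.fourierVec 0 := by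
    simpa [hlam] using hshift 0
  have hne : ∀ m ≠ 0, A.mulVec (ZMod.fourierVec m) =
      ((β₂ : ℂ) * ZMod.stdAddChar m) • ZMod.fourierVec ((g : ZMod p) * m) := by
    intro m hm
    rw [hshift, hlam, if_neg hm]
  have hgpow : (g : ZMod p) ^ (p - 1) = 1 := hg ▸ pow_orderOf_eq_one _
  have hg0 : (g : ZMod p) ≠ 0 := by
    intro h
    rw [h, zero_pow (by omega)] at hgpow
    exact zero_ne_one hgpow
  have hg1 : (g : ZMod p) ≠ 1 := by
    intro h
    rw [h, orderOf_one] at hg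
    omega
  have hgsum : ∑ i ∈ Finset.range (p - 1), (g : ZMod p) ^ i = 0 := by
    rw [geom_sum_eq hg1, hgpow, sub_self, zero_div]
  have hcycle : ∀ m ≠ 0, (A ^ (p - 1)).mulVec (ZMod.fourierVec m) =
      (β₂ : ℂ) ^ (p - 1) • ZMod.fourierVec m := by
    intro m hm
    simp [ZMod.pow_mulVec_fourierVec hg0 hne hm, hgsum, hgpow]
  have hannih : (A ^ (p - 1) - (β₂ : ℂ) ^ (p - 1) • (1 : Matrix (ZMod p) (ZMod p) ℂ)) *
      (A - (β₁ : ℂ) • (1 : Matrix (ZMod p) (ZMod p) ℂ)) = 0 := by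
    refine ZMod.matrix_eq_zero_of_mulVec_fourierVec fun m => ?_
    by_cases hm : m = 0
    · rw [← Matrix.mulVec_mulVec, Matrix.sub_mulVec A, Matrix.smul_mulVec, Matrix.one_mulVec, hm,
        hzero, sub_self, Matrix.mulVec_zero]
    · rw [← Matrix.mulVec_mulVec, Matrix.sub_mulVec A, Matrix.smul_mulVec, Matrix.one_mulVec,
        hne m hm, Matrix.mulVec_sub, Matrix.mulVec_smul, Matrix.mulVec_smul]
      simp only [Matrix.sub_mulVec, Matrix.smul_mulVec, Matrix.one_mulVec, hcycle m hm,
        hcycle _ (mul_ne_zero hg0 hm), sub_self, smul_zero]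
  ext z
  rw [Matrix.mem_spectrum_iff_exists_mulVec, Set.mem_insert_iff, Set.mem_ofPred_eq]
  constructor
  · rintro ⟨v, hv, hAv⟩
    have h := congrArg (fun M => M.mulVec v) hannih
    simp only [← Matrix.mulVec_mulVec, Matrix.zero_mulVec] at h
    rw [Matrix.sub_mulVec A, Matrix.smul_mulVec, Matrix.one_mulVec, hAv, ← sub_smul,
      Matrix.mulVec_smul, Matrix.sub_mulVec, Matrix.smul_mulVec, Matrix.one_mulVec,
      Matrix.pow_mulVec_eq_smul hAv, ← sub_smul, smul_smul, smul_eq_zero, mul_eq_zero,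
      sub_eq_zero, sub_eq_zero] at h
    exact h.resolve_right hv
  · rintro (rfl | hz)
    · exact ⟨_, ZMod.fourierVec_ne_zero 0, hzero⟩
    have hz0 : z ≠ 0 := by
      rintro rfl
      rw [zero_pow (by omega)] at hz
      exact pow_ne_zero _ (Complex.ofReal_ne_zero.2 hβ₂.ne') hz.symm
    refine ⟨_, fun hw => ?_, Matrix.mulVec_sum_inv_pow_smul hz0 (v := ZMod.fourierVec 1)
      (n := p - 1) (by rw [hcycle 1 one_ne_zero, hz])⟩
    -- The Fourier coefficient at frequency `1` comes from the term `k = 0` alone.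
    have h1 : ∑ j, (∑ k ∈ Finset.range (p - 1),
        z⁻¹ ^ k • (A ^ k).mulVec (ZMod.fourierVec 1)) j * ZMod.stdAddChar (-(j * 1)) = 0 := by
      rw [hw]
      simp
    simp only [ZMod.pow_mulVec_fourierVec hg0 hne one_ne_zero, Finset.sum_apply, Pi.smul_apply,
      smul_eq_mul, Finset.sum_mul] at h1
    rw [Finset.sum_comm] at h1
    simp only [mul_assoc, ← Finset.mul_sum, ZMod.sum_fourierVec_mul_neg] at h1
    rw [Finset.sum_eq_single_of_mem 0 (Finset.mem_range.2 (by omega))] at h1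
    · simp [NeZero.ne p] at h1
    · intro k hk hk0
      have : (g : ZMod p) ^ k ≠ 1 :=
        pow_ne_one_of_lt_orderOf hk0 (hg ▸ Finset.mem_range.1 hk)
      simp [this]
end

section
/- Let p be an odd prime, let g be an integer whose residue class generates the group of units (Z/pZ)*, let n ≥ 1, and set φ = exp(2πi/(p−1)) and ω = exp(2πi/n). For 1 ≤ k ≤ n let β_{1k} ∈ ℝ and β_{2k} ≥ 0 with β_{11} ≥ β_{21} ≥ 0, and let B_k = {β_{1k}} ∪ {β_{2k} φ^j : 0 ≤ j ≤ p−2}. Let S_1, …, S_n be g-circulant complex matrices of order p such that the set of eigenvalues of S_k is B_k for every k, such that S_1 is real and entrywise nonnegative, such that S_{n+2−k} equals the entrywise complex conjugate of S_k for 2 ≤ k ≤ n, and such that for every 1 ≤ k ≤ n the p×p matrix L_k = (1/n) Σ_{ℓ=1}^{n} S_ℓ ω^{−(k−1)(ℓ−1)} is real and entrywise nonnegative. Then the np×np matrix C partitioned into p² circulant blocks C(i,j) = circ(c(i,j)), where c_k(i,j) = L_k(i,j) for 1 ≤ k ≤ n, is an entrywise nonnegative g-circulant-by-blocks matrix whose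 set of complex eigenvalues equals ∪_{k=1}^{n} B_k. -/
open scoped ComplexOrder

/-- Orthogonality of the characters `x ↦ stdAddChar (x * b)` of `ZMod n`. -/
lemma ZMod.sum_stdAddChar_mul_s6 (n : ℕ) [NeZero n] (b : ZMod n) :
    ∑ x : ZMod n, ZMod.stdAddChar (x * b) = if b = 0 then (n : ℂ) else 0 := by
  simpa [ZMod.card] using
    AddChar.sum_mulShift b (ZMod.isPrimitive_stdAddChar n)

lemma ZMod.stdAddChar_neg_mul_eq_zpow (n : ℕ) [NeZero n] (k l : ZMod n) :
    ZMod.stdAddChar (-(k * l)) =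
      Complex.exp (2 * Real.pi * Complex.I / n) ^ (-(k.val * l.val : ℤ)) := by
  have h : -(k * l) = ((-(k.val * l.val : ℤ) : ℤ) : ZMod n) := by
    push_cast
    simp
  rw [h, ZMod.stdAddChar_coe, ← Complex.exp_int_mul]
  congr 1
  push_cast
  ring

/-- The discrete Fourier matrix of order `n` is invertible. -/
lemma ZMod.det_stdAddChar_mul_ne_zero (n : ℕ) [NeZero n] :
    (Matrix.of fun a m : ZMod n => (ZMod.stdAddChar (a * m) : ℂ)).det ≠ 0 := by
  have hn : (n : ℂ) ≠ 0 := NeZero.ne _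
  refine Matrix.det_ne_zero_of_right_inverse
    (B := Matrix.of fun m b : ZMod n => (n : ℂ)⁻¹ * ZMod.stdAddChar (-(m * b))) ?_
  ext a b
  have h : ∀ m : ZMod n, (ZMod.stdAddChar (a * m) : ℂ) *
      ((n : ℂ)⁻¹ * ZMod.stdAddChar (-(m * b))) =
      (n : ℂ)⁻¹ * ZMod.stdAddChar (m * (a - b)) := by
    intro m
    rw [show m * (a - b) = a * m + -(m * b) by ring, AddChar.map_add_eq_mul]
    ring
  simp only [Matrix.mul_apply, Matrix.of_apply, h, ← Finset.mul_sum,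
    ZMod.sum_stdAddChar_mul_s6, sub_eq_zero, Matrix.one_apply]
  split_ifs <;> simp [hn]

/-- Fourier inversion on `ZMod n`. -/
lemma ZMod.sum_fourier_coeff_mul (n : ℕ) [NeZero n] (s l : ZMod n → ℂ)
    (hl : ∀ k, l k = (n : ℂ)⁻¹ * ∑ j, s j * ZMod.stdAddChar (-(k * j))) (m : ZMod n) :
    ∑ k, l k * ZMod.stdAddChar (k * m) = s m := by
  have hn : (n : ℂ) ≠ 0 := NeZero.ne _
  have h : ∀ k j : ZMod n, (n : ℂ)⁻¹ * (s j * ZMod.stdAddChar (-(k * j))) *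
      ZMod.stdAddChar (k * m) = (n : ℂ)⁻¹ * s j * ZMod.stdAddChar (k * (m - j)) := by
    intro k j
    rw [show k * (m - j) = -(k * j) + k * m by ring, AddChar.map_add_eq_mul]
    ring
  simp only [hl, Finset.mul_sum, Finset.sum_mul, h]
  rw [Finset.sum_comm]
  simp only [← Finset.mul_sum, ZMod.sum_stdAddChar_mul_s6, sub_eq_zero]
  simp only [mul_ite, mul_zero, Finset.sum_ite_eq, Finset.mem_univ, if_true]
  field_simp

lemma Matrix.mem_spectrum_iff_det_eq_zero {ι : Type*} [Fintype ι] [DecidableEq ι]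
    (A : Matrix ι ι ℂ) (z : ℂ) :
    z ∈ spectrum ℂ A ↔ (z • (1 : Matrix ι ι ℂ) - A).det = 0 := by
  rw [spectrum.mem_iff, Matrix.isUnit_iff_isUnit_det, isUnit_iff_ne_zero, not_not,
    Algebra.algebraMap_eq_smul_one]

lemma Matrix.spectrum_blockDiagonal {ι κ : Type*} [Fintype ι] [DecidableEq ι]
    [Fintype κ] [DecidableEq κ] (S : κ → Matrix ι ι ℂ) :
    spectrum ℂ (Matrix.blockDiagonal S) = ⋃ k, spectrum ℂ (S k) := by
  ext z
  have h : z • (1 : Matrix (ι × κ) (ι × κ) ℂ) - Matrix.blockDiagonal S =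
      Matrix.blockDiagonal fun k => z • (1 : Matrix ι ι ℂ) - S k := by
    rw [← Matrix.blockDiagonal_one, ← Matrix.blockDiagonal_smul, ← Matrix.blockDiagonal_sub]
    rfl
  simp only [Set.mem_iUnion, Matrix.mem_spectrum_iff_det_eq_zero, h,
    Matrix.det_blockDiagonal, Finset.prod_eq_zero_iff, Finset.mem_univ, true_and]

lemma Matrix.spectrum_eq_of_mul_eq_mul {ι : Type*} [Fintype ι] [DecidableEq ι]
    {A D F : Matrix ι ι ℂ} (hF : F.det ≠ 0) (h : A * F = F * D) :
    spectrum ℂ A = spectrum ℂ D := by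
  ext z
  have hz : (z • (1 : Matrix ι ι ℂ) - A) * F = F * (z • (1 : Matrix ι ι ℂ) - D) := by
    simp [sub_mul, mul_sub, h]
  have hdet := congrArg Matrix.det hz
  rw [Matrix.det_mul, Matrix.det_mul, mul_comm] at hdet
  rw [Matrix.mem_spectrum_iff_det_eq_zero, Matrix.mem_spectrum_iff_det_eq_zero,
    mul_left_cancel₀ hF hdet]

/-- A matrix with circulant blocks is block diagonalized by the discrete Fourier transform. -/
lemma Matrix.spectrum_of_circulant_blocks {ι : Type*} [Fintype ι] [DecidableEq ι]
    (n : ℕ) [NeZero n] (S L : ZMod n → Matrix ι ι ℂ)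
    (hL : ∀ k i j, L k i j = (n : ℂ)⁻¹ * ∑ l, S l i j * ZMod.stdAddChar (-(k * l)))
    (C : Matrix (ι × ZMod n) (ι × ZMod n) ℂ)
    (hC : ∀ i j a b, C (i, a) (j, b) = L (b - a) i j) :
    spectrum ℂ C = ⋃ k, spectrum ℂ (S k) := by
  rw [← Matrix.spectrum_blockDiagonal]
  refine Matrix.spectrum_eq_of_mul_eq_mul
    (F := Matrix.kroneckerMap (· * ·) (1 : Matrix ι ι ℂ)
      (Matrix.of fun a m : ZMod n => (ZMod.stdAddChar (a * m) : ℂ))) ?_ ?_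
  · rw [Matrix.det_kronecker]
    simpa using pow_ne_zero _ (ZMod.det_stdAddChar_mul_ne_zero n)
  · ext ⟨i, a⟩ ⟨j, m⟩
    have hinv := ZMod.sum_fourier_coeff_mul n (fun l => S l i j) (fun k => L k i j)
      (fun k => hL k i j) m
    simp only [Matrix.mul_apply, Fintype.sum_prod_type, Matrix.kroneckerMap_apply,
      Matrix.of_apply, Matrix.one_apply, hC, Matrix.blockDiagonal_apply, ite_mul, one_mul,
      zero_mul, mul_ite, mul_zero, Finset.sum_ite_eq, Finset.sum_ite_eq', Finset.mem_univ,
      if_true, Finset.sum_ite_irrel, Finset.sum_const_zero]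
    rw [← hinv, ← Equiv.sum_comp (Equiv.subRight a)
      (fun k => L k i j * ZMod.stdAddChar (k * m)), Finset.mul_sum]
    refine Finset.sum_congr rfl fun b _ => ?_
    rw [Equiv.subRight_apply, mul_left_comm, ← AddChar.map_add_eq_mul]
    congr 2
    ring

/-- Let `p` be an odd prime, `g` a generator of `(ZMod p)ˣ`, `n ≥ 1`,
`φ = exp(2πi/(p-1))`, `ω = exp(2πi/n)`.  Given (0-indexed, `k ∈ ZMod n`) reals
`β₁ₖ` and `β₂ₖ ≥ 0` with `β₁₀ ≥ β₂₀ ≥ 0`, sets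
`Bₖ = {β₁ₖ} ∪ {β₂ₖ φ^j : 0 ≤ j ≤ p-2}`, and `g`-circulant complex matrices `Sₖ` of
order `p` with spectrum `Bₖ`, such that `S₀` is (real) nonnegative,
`S₋ₖ = conj Sₖ` for `k ≠ 0`, and every
`Lₖ = (1/n) ∑_ℓ S_ℓ ω^{-kℓ}` is (real) nonnegative, the `np × np` matrix `C` with
circulant blocks `C(i,j) = circ(c(i,j))`, `cₖ(i,j) = Lₖ(i,j)`, is an entrywise
nonnegative `g`-circulant-by-blocks matrix with spectrum `⋃ₖ Bₖ`. -/
theorem blockGCirc_nonneg_realization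
    (p n : ℕ) [Fact p.Prime] (hp : Odd p) [NeZero n] (hn : 1 ≤ n)
    (g : ℤ) (hg : orderOf ((g : ZMod p)) = p - 1)
    (φ ω : ℂ)
    (hφ : φ = Complex.exp (2 * Real.pi * Complex.I / ((p : ℂ) - 1)))
    (hω : ω = Complex.exp (2 * Real.pi * Complex.I / n))
    (β₁ β₂ : ZMod n → ℝ) (hβ₂ : ∀ k, 0 ≤ β₂ k)
    (hβ11 : β₂ 0 ≤ β₁ 0) (hβ21 : 0 ≤ β₂ 0)
    (B : ZMod n → Set ℂ)
    (hB : ∀ k, B k = insert ((β₁ k : ℂ))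
      {z : ℂ | ∃ j : ℕ, j ≤ p - 2 ∧ z = (β₂ k : ℂ) * φ ^ j})
    (S : ZMod n → Matrix (ZMod p) (ZMod p) ℂ)
    (hScirc : ∀ (k : ZMod n) (i j : ZMod p), S k i j = S k 0 (j - (g : ZMod p) * i))
    (hSspec : ∀ k : ZMod n, spectrum ℂ (S k) = B k)
    (hS1 : ∀ i j : ZMod p, 0 ≤ S 0 i j)
    (hconj : ∀ k : ZMod n, k ≠ 0 → ∀ i j : ZMod p, S (-k) i j = starRingEnd ℂ (S k i j))
    (L : ZMod n → Matrix (ZMod p) (ZMod p) ℂ)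
    (hL : ∀ (k : ZMod n) (i j : ZMod p),
      L k i j = (n : ℂ)⁻¹ * ∑ ℓ : ZMod n, S ℓ i j * ω ^ (-(k.val * ℓ.val : ℤ)))
    (hLpos : ∀ (k : ZMod n) (i j : ZMod p), 0 ≤ L k i j)
    (C : Matrix (ZMod p × ZMod n) (ZMod p × ZMod n) ℂ)
    (hC : ∀ (i j : ZMod p) (a b : ZMod n), C (i, a) (j, b) = L (b - a) i j) :
    (∀ x y, 0 ≤ C x y) ∧
    (∀ (i j : ZMod p) (a b : ZMod n),
      C (i, a) (j, b) = C (i + 1, a) (j + (g : ZMod p), b)) ∧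
    spectrum ℂ C = ⋃ k : ZMod n, B k := by
  refine ⟨fun x y => ?_, fun i j a b => ?_, ?_⟩
  · rw [← Prod.mk.eta (p := x), ← Prod.mk.eta (p := y), hC]
    exact hLpos _ _ _
  · simp only [hC, hL]
    congr 1
    refine Finset.sum_congr rfl fun l _ => ?_
    rw [hScirc l i j, hScirc l (i + 1) (j + g)]
    rw [show j + (g : ZMod p) - g * (i + 1) = j - g * i by ring]
  · simp only [← hSspec]
    refine Matrix.spectrum_of_circulant_blocks n S L (fun k i j => ?_) C hC
    simp only [hL, hω, ZMod.stdAddChar_neg_mul_eq_zpow]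
end

section
/- Let n be a positive integer and g an integer with gcd(n, g) = 1, and let g^{-1} denote an integer with g·g^{-1} ≡ 1 (mod n). An n×n complex matrix A is g-circulant if and only if there exists a diagonal complex matrix D such that A = F · Q_{g^{-1}} · D · F*, where F is the n×n Discrete Fourier Transform matrix and F* its conjugate transpose. -/
/-- A power of `exp (2πi/n)` indexed by residues is a value of the standard additive character. -/
theorem exp_pow_val_mul_val (n : ℕ) [NeZero n] (j k : ZMod n) :
    Complex.exp (2 * Real.pi * Complex.I / n) ^ (j.val * k.val) = ZMod.stdAddChar (j * k) := by
  have h := ZMod.stdAddChar_coe (N := n) ((j.val * k.val : ℕ) : ℤ)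
  have hjk : (((j.val * k.val : ℕ) : ℤ) : ZMod n) = j * k := by simp
  rw [hjk] at h
  rw [h, ← Complex.exp_nat_mul]
  congr 1
  push_cast
  ring

/-- Fourier expansion of the entries of `F * Q * diagonal d * Fᴴ`. -/
theorem fourier_mul_perm_mul_diagonal_apply (n : ℕ) [NeZero n] (g h : ZMod n) (hgh : g * h = 1)
    (F Q : Matrix (ZMod n) (ZMod n) ℂ)
    (hF : ∀ j k : ZMod n, F j k = ZMod.stdAddChar (j * k) / (Real.sqrt n : ℂ))
    (hQ : ∀ i j : ZMod n, Q i j = if j = h * i then 1 else 0)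
    (d : ZMod n → ℂ) (i j : ZMod n) :
    (F * Q * Matrix.diagonal d * F.conjTranspose) i j =
      (∑ l, d l * ZMod.stdAddChar (-((j - g * i) * l))) / n := by
  have hs : (Real.sqrt n : ℂ) * (Real.sqrt n : ℂ) = n := by
    rw [← Complex.ofReal_mul, Real.mul_self_sqrt n.cast_nonneg, Complex.ofReal_natCast]
  have hFQ (l : ZMod n) : (F * Q) i l = F i (g * l) := by
    have hiff (k : ZMod n) : l = h * k ↔ k = g * l := by
      constructor
      · rintro rfl
        rw [← mul_assoc, hgh, one_mul]
      · rintro rfl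
        rw [← mul_assoc, mul_comm h, hgh, one_mul]
    simp [Matrix.mul_apply, hQ, hiff]
  rw [Matrix.mul_apply, Finset.sum_div]
  refine Finset.sum_congr rfl fun l _ => ?_
  have hsplit : -((j - g * i) * l) = i * (g * l) + -(j * l) := by ring
  rw [Matrix.mul_diagonal, hFQ, Matrix.conjTranspose_apply, hF, hF, hsplit,
    AddChar.map_add_eq_mul, AddChar.map_neg_eq_conj, ← hs]
  simp only [RCLike.star_def, map_div₀, Complex.conj_ofReal]
  ring

/-- Fourier inversion on `ZMod n`. -/
theorem fourier_inversion_zmod (n : ℕ) [NeZero n] (a : ZMod n → ℂ) (x : ZMod n) :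
    (∑ l, (∑ m, a m * ZMod.stdAddChar (m * l)) * ZMod.stdAddChar (-(x * l))) / (n : ℂ) = a x := by
  have hn : (n : ℂ) ≠ 0 := NeZero.ne _
  have hterm (l m : ZMod n) : a m * ZMod.stdAddChar (m * l) * ZMod.stdAddChar (-(x * l)) =
      a m * ZMod.stdAddChar (l * (m - x)) := by
    rw [mul_assoc, ← AddChar.map_add_eq_mul]
    congr 2
    ring
  simp_rw [Finset.sum_mul, hterm]
  rw [Finset.sum_comm]
  simp_rw [← Finset.mul_sum, AddChar.sum_mulShift _ (ZMod.isPrimitive_stdAddChar n), sub_eq_zero]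
  simp [ZMod.card, hn]


/-- Let `gcd(n,g) = 1` and `g⁻¹` an integer with `g·g⁻¹ ≡ 1 (mod n)`.
An `n × n` complex matrix `A` is `g`-circulant iff `A = F ⬝ Q_{g⁻¹} ⬝ D ⬝ F*` for some
diagonal matrix `D`, where `F` is the Discrete Fourier Transform matrix
`F(j,k) = ω^{jk}/√n`, `ω = exp(2πi/n)`. -/
theorem gcirc_iff_fourier_diagonal
    (n : ℕ) [NeZero n] (g ginv : ℤ) (hgcd : Int.gcd (n : ℤ) g = 1)
    (hginv : ((g * ginv : ℤ) : ZMod n) = 1)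
    (ω : ℂ) (hω : ω = Complex.exp (2 * Real.pi * Complex.I / n))
    (F : Matrix (ZMod n) (ZMod n) ℂ)
    (hF : ∀ j k : ZMod n, F j k = ω ^ (j.val * k.val) / (Real.sqrt n : ℂ))
    (Qginv : Matrix (ZMod n) (ZMod n) ℂ)
    (hQ : ∀ i j : ZMod n, Qginv i j = if j = (ginv : ZMod n) * i then 1 else 0)
    (A : Matrix (ZMod n) (ZMod n) ℂ) :
    (∀ i j : ZMod n, A i j = A 0 (j - (g : ZMod n) * i)) ↔
      ∃ d : ZMod n → ℂ, A = F * Qginv * Matrix.diagonal d * F.conjTranspose := by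
  have hgh : (g : ZMod n) * (ginv : ZMod n) = 1 := by exact_mod_cast hginv
  have hF' (j k : ZMod n) : F j k = ZMod.stdAddChar (j * k) / (Real.sqrt n : ℂ) := by
    rw [hF, hω, exp_pow_val_mul_val]
  have key := fourier_mul_perm_mul_diagonal_apply n g ginv hgh F Qginv hF' hQ
  constructor
  · intro hA
    refine ⟨fun l => ∑ m, A 0 m * ZMod.stdAddChar (m * l), ?_⟩
    ext i j
    rw [key, fourier_inversion_zmod, hA]
  · rintro ⟨d, rfl⟩ i j
    rw [key, key, mul_zero, sub_zero]
end

section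
/- Let n be a prime and let g be an integer with 1 < g < n. Then every g-circulant real matrix of order n is symmetric (for every choice of first row) if and only if g = n − 1; precisely, the statement 'for all a : Z/nZ → ℝ, the g-circulant matrix with first row a is symmetric' holds if and only if g ≡ n − 1 (mod n). -/
/-- Let `n` be prime and `1 < g < n`.  Every `g`-circulant real matrix of
order `n` (with first row `a`, entries `A i j = a (j - g·i)`) is symmetric, for every
choice of first row, if and only if `g ≡ n - 1 (mod n)`. -/
theorem gcirc_symmetric_iff
    (n : ℕ) [Fact n.Prime] (g : ℤ) (h1 : 1 < g) (h2 : g < (n : ℤ)) :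
    (∀ a : ZMod n → ℝ, ∀ i j : ZMod n,
        a (j - (g : ZMod n) * i) = a (i - (g : ZMod n) * j)) ↔
      (g : ZMod n) = ((n - 1 : ℕ) : ZMod n) := by
  have hn : ((n - 1 : ℕ) : ZMod n) = -1 := by
    rw [Nat.cast_sub (Fact.out : n.Prime).one_le]
    simp
  rw [hn]
  constructor
  · intro h
    have h01 := h (fun x => if x = 1 then 1 else 0) 0 1
    by_contra hg
    have hne : -(g : ZMod n) ≠ 1 := fun h' => hg (neg_eq_iff_eq_neg.mp h')
    simp [hne] at h01
  · intro hg a i j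
    rw [hg]
    congr 1
    ring
end

section
/- Let n be a positive integer and g an integer with gcd(n, g) = 1, and let g^{-1} denote an integer with g·g^{-1} ≡ 1 (mod n). If A is an invertible g-circulant complex matrix of order n, then A^{-1} is a g^{-1}-circulant matrix. -/
/-- The inverse of a matrix invariant under simultaneous translation of rows by `s` and columns
by `t` is invariant under translation of rows by `t` and columns by `s`. -/
theorem Matrix.inv_apply_add_add {G R : Type*} [AddGroup G] [Fintype G] [DecidableEq G]
    [CommRing R] {A : Matrix G G R} {s t : G} (hA : ∀ i j, A (i + s) (j + t) = A i j) (i j : G) :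
    A⁻¹ (i + t) (j + s) = A⁻¹ i j := by
  have h : A.submatrix (Equiv.addRight s) (Equiv.addRight t) = A := Matrix.ext hA
  have h' := Matrix.inv_submatrix_equiv A (Equiv.addRight s) (Equiv.addRight t)
  rw [h] at h'
  exact (congrFun₂ h' i j).symm

/-- Let `gcd(n,g) = 1` and `g⁻¹` an integer with `g·g⁻¹ ≡ 1 (mod n)`.
If `A` is an invertible `g`-circulant complex matrix of order `n`
(`A i j = a (j - g·i)` with `a` the first row of `A`), then `A⁻¹` is `g⁻¹`-circulant. -/
theorem inv_gcirc_is_ginv_circ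
    (n : ℕ) [NeZero n] (g ginv : ℤ) (hgcd : Int.gcd (n : ℤ) g = 1)
    (hginv : ((g * ginv : ℤ) : ZMod n) = 1)
    (A : Matrix (ZMod n) (ZMod n) ℂ)
    (hA : ∀ i j : ZMod n, A i j = A 0 (j - (g : ZMod n) * i))
    (hunit : IsUnit A) :
    ∀ i j : ZMod n, A⁻¹ i j = A⁻¹ 0 (j - (ginv : ZMod n) * i) := by
  intro i j
  have hg : (g : ZMod n) * (ginv : ZMod n) = 1 := by exact_mod_cast hginv
  have hshift : ∀ k l : ZMod n, A (k + -(ginv * i)) (l + -i) = A k l := by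
    intro k l
    rw [hA (k + -(ginv * i)), hA k l]
    congr 1
    linear_combination i * hg
  have h := Matrix.inv_apply_add_add hshift i j
  rw [add_neg_cancel, ← sub_eq_add_neg] at h
  exact h.symm
end

section
/- Let σ be a permutation of {1, …, n} that is a single cycle of length n (an n-cycle), let P_σ be its permutation matrix, and let D = diag(d_1, …, d_n) be a complex diagonal matrix. Then the characteristic polynomial of the PD-matrix S = P_σ · D is X^n − d_1 d_2 ⋯ d_n; consequently the complex eigenvalues of S are exactly the n-th roots of the product d_1 d_2 ⋯ d_n. -/
/-- A permutation sending every point `i` either to itself or to `σ i`, where `σ` is a cycle moving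
every point, is trivial or equal to `σ`. -/
theorem Equiv.Perm.IsCycle.eq_one_or_eq_of_forall_s18 {α : Type*} [Finite α] {σ τ : Equiv.Perm α}
    (hσ : σ.IsCycle) (hmove : ∀ i, σ i ≠ i) (h : ∀ i, τ i = i ∨ τ i = σ i) :
    τ = 1 ∨ τ = σ := by
  by_cases hτ : ∀ i, τ i = i
  · exact Or.inl (Equiv.ext hτ)
  · right
    push Not at hτ
    obtain ⟨a, ha⟩ := hτ
    have step (k : ℕ) : τ ((σ ^ k) a) = σ ((σ ^ k) a) := by
      induction k with
      | zero => exact (h a).resolve_left ha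
      | succ k ih =>
        refine (h _).resolve_left fun hfix => hmove ((σ ^ k) a) ?_
        rw [pow_succ', Equiv.Perm.mul_apply, ← ih] at hfix
        rw [← ih]
        exact τ.injective hfix
    ext x
    obtain ⟨k, rfl⟩ := hσ.exists_pow_eq (hmove a) (hmove x)
    exact step k

/-- The characteristic polynomial of a matrix with entries `d j` at the positions `(i, j)` with
`σ i = j` and zero elsewhere, where `σ` is a cycle moving every point. -/
theorem Matrix.charpoly_of_isCycle {α R : Type*} [Fintype α] [DecidableEq α] [CommRing R]
    {σ : Equiv.Perm α} (hσ : σ.IsCycle) (hmove : ∀ i, σ i ≠ i) (d : α → R) :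
    (Matrix.of fun i j => if σ i = j then d j else 0).charpoly =
      Polynomial.X ^ Fintype.card α - Polynomial.C (∏ i, d i) := by
  have hsupp : σ.support = Finset.univ := by
    ext i
    simp [hmove i]
  rw [Matrix.charpoly, ← Matrix.det_transpose, Matrix.det_apply',
    ← Finset.sum_subset (Finset.subset_univ {1, σ}), Finset.sum_pair hσ.ne_one.symm]
  · have h_one : ∏ i, (Matrix.of fun i j => if σ i = j then d j else 0).charmatrix.transpose
        ((1 : Equiv.Perm α) i) i = Polynomial.X ^ Fintype.card α := by
      simp [Matrix.charmatrix_apply_eq, hmove]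
    have h_cycle :
        ∏ i, (Matrix.of fun i j => if σ i = j then d j else 0).charmatrix.transpose (σ i) i =
        (-1) ^ Fintype.card α * Polynomial.C (∏ i, d i) := by
      simp only [Matrix.transpose_apply, Matrix.charmatrix_apply_ne _ _ _ (hmove _).symm,
        Matrix.of_apply, if_true, Finset.prod_neg, Finset.card_univ, map_prod]
      rw [Equiv.prod_comp σ fun j => Polynomial.C (d j)]
    rw [h_one, h_cycle, hσ.sign, hsupp, Finset.card_univ]
    have hsq : ((-1 : Polynomial R) ^ Fintype.card α) * (-1) ^ Fintype.card α = 1 := by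
      rw [← mul_pow]
      simp
    push_cast
    simp only [Equiv.Perm.sign_one, Units.val_one, Int.cast_one, one_mul]
    linear_combination (-Polynomial.C (∏ i, d i)) * hsq
  · intro τ _ hτ
    have hex : ∃ i, τ i ≠ i ∧ τ i ≠ σ i := by
      by_contra! hcon
      refine hτ ?_
      simpa using hσ.eq_one_or_eq_of_forall_s18 hmove fun i => or_iff_not_imp_left.mpr (hcon i)
    obtain ⟨i, hi, hi'⟩ := hex
    refine mul_eq_zero_of_right _ (Finset.prod_eq_zero (Finset.mem_univ i) ?_)
    rw [Matrix.transpose_apply, Matrix.charmatrix_apply_ne _ _ _ hi.symm]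
    simp [hi'.symm]


/-- Let `σ` be an `n`-cycle on `{1,…,n}` (a single cycle moving every
point), `P_σ` its permutation matrix (`P_σ(i,j) = 1` iff `j = σ i`), and
`D = diag(d₁,…,dₙ)` a complex diagonal matrix.  Then the characteristic polynomial of
the PD-matrix `S = P_σ ⬝ D` is `X^n - d₁⋯dₙ`, and consequently the complex eigenvalues
of `S` are exactly the `n`-th roots of `d₁⋯dₙ`. -/
theorem pd_matrix_charpoly_of_cycle
    (n : ℕ) (σ : Equiv.Perm (Fin n)) (hσ : σ.IsCycle)
    (hsupp : σ.support = Finset.univ)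
    (d : Fin n → ℂ)
    (P : Matrix (Fin n) (Fin n) ℂ)
    (hP : ∀ i j : Fin n, P i j = if σ i = j then 1 else 0)
    (S : Matrix (Fin n) (Fin n) ℂ) (hS : S = P * Matrix.diagonal d) :
    S.charpoly = Polynomial.X ^ n - Polynomial.C (∏ i, d i) ∧
    ∀ μ : ℂ, μ ∈ spectrum ℂ S ↔ μ ^ n = ∏ i, d i := by
  have hmove (i : Fin n) : σ i ≠ i := by
    rw [← Equiv.Perm.mem_support, hsupp]
    exact Finset.mem_univ i
  have hS' : S = Matrix.of fun i j => if σ i = j then d j else 0 := by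
    ext i j
    simp [hS, hP]
  have hchar : S.charpoly = Polynomial.X ^ n - Polynomial.C (∏ i, d i) := by
    rw [hS', Matrix.charpoly_of_isCycle hσ hmove, Fintype.card_fin]
  refine ⟨hchar, fun μ => ?_⟩
  rw [Matrix.mem_spectrum_iff_isRoot_charpoly, hchar, Polynomial.IsRoot.def, Polynomial.eval_sub,
    Polynomial.eval_pow, Polynomial.eval_X, Polynomial.eval_C, sub_eq_zero]
end
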